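/- arXiv:2405.03249 — 2 statements merged into one kernel-verified Lean document; each statement's English description precedes it below -/
import Mathlib

section
/- Let f = (f11,f12,f22) be a symmetric 2-tensor field with C² components compactly supported in the open unit disk, and assume u1 ≠ u2. Then for every x ∈ ℝ², f22(x) = (1/(2·(u1² - u2²)))·[ D_u D_v (L¹f)(x) + D_u(Lf)(x) + D_v(Lf)(x) + (u1²/u2)·D_u D_v X_{e2}(Lf + Tf)(x) ]. -/
open MeasureTheory

noncomputable section

/-- Rotation of a vector by 90 degrees: `w⊥ = (-w2, w1)`. -/
def perp (w : ℝ × ℝ) : ℝ × ℝ := (-w.2, w.1)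

/-- Divergent beam transform `X_w h (x) = ∫_0^∞ h(x + t w) dt`. -/
def Xray (w : ℝ × ℝ) (h : ℝ × ℝ → ℝ) (x : ℝ × ℝ) : ℝ :=
  ∫ t in Set.Ioi (0:ℝ), h (x + t • w)

/-- First moment divergent beam transform `X¹_w h (x) = ∫_0^∞ t·h(x + t w) dt`. -/
def Xray1 (w : ℝ × ℝ) (h : ℝ × ℝ → ℝ) (x : ℝ × ℝ) : ℝ :=
  ∫ t in Set.Ioi (0:ℝ), t * h (x + t • w)

/-- Directional derivative `D_w h = w1 ∂h/∂x1 + w2 ∂h/∂x2`. -/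
def Dw (w : ℝ × ℝ) (h : ℝ × ℝ → ℝ) (x : ℝ × ℝ) : ℝ :=
  fderiv ℝ h x w

/-- Partial derivative in the first coordinate. -/
def pdx (h : ℝ × ℝ → ℝ) : ℝ × ℝ → ℝ := Dw (1, 0) h

/-- Partial derivative in the second coordinate. -/
def pdy (h : ℝ × ℝ → ℝ) : ℝ × ℝ → ℝ := Dw (0, 1) h

/-- The open unit disk in ℝ². -/
def unitDisk : Set (ℝ × ℝ) := {x | x.1 ^ 2 + x.2 ^ 2 < 1}

/-- `⟨f, w²⟩ = f11 w1² + 2 f12 w1 w2 + f22 w2²`. -/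
def proj2 (f11 f12 f22 : ℝ × ℝ → ℝ) (w : ℝ × ℝ) (x : ℝ × ℝ) : ℝ :=
  f11 x * w.1 ^ 2 + 2 * f12 x * w.1 * w.2 + f22 x * w.2 ^ 2

/-- `⟨f, w ⊙ w⊥⟩ = -f11 w1 w2 + f12 (w1² - w2²) + f22 w1 w2`. -/
def projMix (f11 f12 f22 : ℝ × ℝ → ℝ) (w : ℝ × ℝ) (x : ℝ × ℝ) : ℝ :=
  -(f11 x) * w.1 * w.2 + f12 x * (w.1 ^ 2 - w.2 ^ 2) + f22 x * w.1 * w.2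

/-- V-line transform of a scalar function. -/
def Vlt (u v : ℝ × ℝ) (h : ℝ × ℝ → ℝ) (x : ℝ × ℝ) : ℝ := Xray u h x + Xray v h x

/-- Longitudinal V-line transform. -/
def Lf (u v : ℝ × ℝ) (f11 f12 f22 : ℝ × ℝ → ℝ) (x : ℝ × ℝ) : ℝ :=
  Xray u (proj2 f11 f12 f22 u) x + Xray v (proj2 f11 f12 f22 v) x

/-- Transverse V-line transform. -/
def Tf (u v : ℝ × ℝ) (f11 f12 f22 : ℝ × ℝ → ℝ) (x : ℝ × ℝ) : ℝ :=
  Xray u (proj2 f11 f12 f22 (perp u)) x + Xray v (proj2 f11 f12 f22 (perp v)) x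

/-- Mixed V-line transform. -/
def Mf (u v : ℝ × ℝ) (f11 f12 f22 : ℝ × ℝ → ℝ) (x : ℝ × ℝ) : ℝ :=
  Xray u (projMix f11 f12 f22 u) x + Xray v (projMix f11 f12 f22 v) x

/-- First moment longitudinal V-line transform. -/
def L1f (u v : ℝ × ℝ) (f11 f12 f22 : ℝ × ℝ → ℝ) (x : ℝ × ℝ) : ℝ :=
  Xray1 u (proj2 f11 f12 f22 u) x + Xray1 v (proj2 f11 f12 f22 v) x
open Set Filter Topology

section RayIntegrals

variable {E : Type*} [NormedAddCommGroup E] [NormedSpace ℝ E]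

/-- Functions vanishing on the half-plane `y₂ > 1`. -/
def VanishesAbove (h : ℝ × ℝ → E) : Prop := ∀ y : ℝ × ℝ, 1 < y.2 → h y = 0

/-- The weighted beam transform `∫_0^∞ φ(t) h(x + t w) dt`. -/
def weightedRay (φ : ℝ → ℝ) (w : ℝ × ℝ) (h : ℝ × ℝ → E) (x : ℝ × ℝ) : E :=
  ∫ t in Ioi (0 : ℝ), φ t • h (x + t • w)

theorem weightedRay_one (w : ℝ × ℝ) (h : ℝ × ℝ → ℝ) : weightedRay (fun _ => 1) w h = Xray w h := by
  ext x; simp [weightedRay, Xray]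

theorem weightedRay_id (w : ℝ × ℝ) (h : ℝ × ℝ → ℝ) : weightedRay (fun t => t) w h = Xray1 w h := by
  ext x; simp [weightedRay, Xray1]

theorem VanishesAbove.fderiv {h : ℝ × ℝ → E} (hh : VanishesAbove h) :
    VanishesAbove (fderiv ℝ h) := by
  intro y hy
  have : h =ᶠ[𝓝 y] fun _ => 0 := by
    filter_upwards [(isOpen_lt continuous_const continuous_snd).mem_nhds hy] with z hz
    exact hh z hz
  rw [this.fderiv_eq]
  simp

theorem VanishesAbove.weightedRay {h : ℝ × ℝ → E} (hh : VanishesAbove h) (φ : ℝ → ℝ)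
    {w : ℝ × ℝ} (hw : 0 < w.2) : VanishesAbove (weightedRay φ w h) := by
  intro y hy
  refine setIntegral_eq_zero_of_forall_eq_zero fun t (ht : 0 < t) => ?_
  rw [hh, smul_zero]
  simp only [Prod.snd_add, Prod.smul_snd, smul_eq_mul]
  nlinarith [mul_pos ht hw]

/-- A locally uniform integrable bound for the integrand of the weighted beam transform. -/
theorem VanishesAbove.exists_bound {h : ℝ × ℝ → E} (hh : VanishesAbove h) (hc : Continuous h)
    {φ : ℝ → ℝ} (hφ : Continuous φ) {w : ℝ × ℝ} (hw : 0 < w.2) (x₀ : ℝ × ℝ) :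
    ∃ b : ℝ → ℝ, IntegrableOn b (Ioi 0) ∧
      ∀ t ∈ Ioi (0 : ℝ), ∀ x ∈ Metric.ball x₀ 1, ‖φ t • h (x + t • w)‖ ≤ b t := by
  set R := (2 - x₀.2) / w.2
  obtain ⟨C, hC⟩ := ((isCompact_closedBall x₀ 1).prod
    (isCompact_Icc (a := (0 : ℝ)) (b := R))).exists_bound_of_continuousOn
    (f := fun p : (ℝ × ℝ) × ℝ => φ p.2 • h (p.1 + p.2 • w)) (by fun_prop)
  refine ⟨(Icc 0 R).indicator fun _ => C, ?_, fun t ht x hx => ?_⟩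
  · exact ((integrable_indicator_iff measurableSet_Icc).2
      (by simp [integrableOn_const_iff])).integrableOn
  · by_cases htR : t ≤ R
    · rw [indicator_of_mem (show t ∈ Icc 0 R from ⟨le_of_lt ht, htR⟩)]
      exact hC (x, t) ⟨Metric.ball_subset_closedBall hx, le_of_lt ht, htR⟩
    · rw [indicator_of_notMem (fun h' => htR h'.2), hh, smul_zero, norm_zero]
      have h1 : |x.2 - x₀.2| < 1 := by
        have := (max_lt_iff.1 (Metric.mem_ball.1 hx)).2
        rwa [Real.dist_eq] at this
      have h2 : 2 - x₀.2 < t * w.2 := (div_lt_iff₀ hw).1 (not_le.1 htR)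
      simp only [Prod.snd_add, Prod.smul_snd, smul_eq_mul]
      linarith [(abs_lt.1 h1).1]

theorem aestronglyMeasurable_ray {h : ℝ × ℝ → E} (hc : Continuous h) {φ : ℝ → ℝ}
    (hφ : Continuous φ) (w x : ℝ × ℝ) :
    AEStronglyMeasurable (fun t => φ t • h (x + t • w)) (volume.restrict (Ioi (0 : ℝ))) :=
  Continuous.aestronglyMeasurable (by fun_prop)

theorem VanishesAbove.integrableOn_ray {h : ℝ × ℝ → E} (hh : VanishesAbove h) (hc : Continuous h)
    {φ : ℝ → ℝ} (hφ : Continuous φ) {w : ℝ × ℝ} (hw : 0 < w.2) (x : ℝ × ℝ) :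
    IntegrableOn (fun t => φ t • h (x + t • w)) (Ioi 0) := by
  obtain ⟨b, hb, hle⟩ := hh.exists_bound hc hφ hw x
  refine Integrable.mono' hb (aestronglyMeasurable_ray hc hφ w x) ?_
  exact ae_restrict_of_forall_mem measurableSet_Ioi
    fun t ht => hle t ht x (Metric.mem_ball_self one_pos)

theorem VanishesAbove.continuous_weightedRay {h : ℝ × ℝ → E} (hh : VanishesAbove h)
    (hc : Continuous h) {φ : ℝ → ℝ} (hφ : Continuous φ) {w : ℝ × ℝ} (hw : 0 < w.2) :
    Continuous (_root_.weightedRay φ w h) := by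
  refine continuous_iff_continuousAt.2 fun x₀ => ?_
  obtain ⟨b, hb, hle⟩ := hh.exists_bound hc hφ hw x₀
  refine continuousAt_of_dominated (bound := b)
    (.of_forall fun x => aestronglyMeasurable_ray hc hφ w x) ?_ hb
    (.of_forall fun t => by fun_prop)
  filter_upwards [Metric.ball_mem_nhds x₀ one_pos] with x hx
  exact ae_restrict_of_forall_mem measurableSet_Ioi fun t ht => hle t ht x hx

theorem VanishesAbove.hasFDerivAt_weightedRay {h : ℝ × ℝ → E} (hh : VanishesAbove h)
    (hc : ContDiff ℝ 1 h) {φ : ℝ → ℝ} (hφ : Continuous φ) {w : ℝ × ℝ} (hw : 0 < w.2)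
    (x₀ : ℝ × ℝ) :
    HasFDerivAt (_root_.weightedRay φ w h) (_root_.weightedRay φ w (_root_.fderiv ℝ h) x₀) x₀ := by
  have hc' : Continuous (_root_.fderiv ℝ h) := hc.continuous_fderiv one_ne_zero
  obtain ⟨b, hb, hle⟩ := hh.fderiv.exists_bound hc' hφ hw x₀
  refine hasFDerivAt_integral_of_dominated_of_fderiv_le (bound := b)
    (F := fun x t => φ t • h (x + t • w)) (F' := fun x t => φ t • _root_.fderiv ℝ h (x + t • w))
    (Metric.ball_mem_nhds x₀ one_pos)
    (.of_forall fun x => aestronglyMeasurable_ray hc.continuous hφ w x)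
    (hh.integrableOn_ray hc.continuous hφ hw x₀) (aestronglyMeasurable_ray hc' hφ w x₀)
    (ae_restrict_of_forall_mem measurableSet_Ioi hle) hb (.of_forall fun t x _ => ?_)
  have hd := (hc.differentiable one_ne_zero (x + t • w)).hasFDerivAt
  exact (hd.comp x ((hasFDerivAt_id x).add_const (t • w))).const_smul (φ t)

theorem VanishesAbove.contDiff_weightedRay {h : ℝ × ℝ → E} (hh : VanishesAbove h)
    (hc : ContDiff ℝ 1 h) {φ : ℝ → ℝ} (hφ : Continuous φ) {w : ℝ × ℝ} (hw : 0 < w.2) :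
    ContDiff ℝ 1 (_root_.weightedRay φ w h) := by
  have hd := hh.hasFDerivAt_weightedRay hc hφ hw
  refine contDiff_one_iff_fderiv.2 ⟨fun x => (hd x).differentiableAt, ?_⟩
  rw [funext fun x => (hd x).fderiv]
  exact hh.fderiv.continuous_weightedRay (hc.continuous_fderiv one_ne_zero) hφ hw

end RayIntegrals

/-- `C^n` functions vanishing on the half-plane `y₂ > 1`. -/
structure RayAdmissible (n : ℕ) (h : ℝ × ℝ → ℝ) : Prop where
  contDiff : ContDiff ℝ n h
  vanishesAbove : VanishesAbove h

theorem Dw_add {h k : ℝ × ℝ → ℝ} (hh : Differentiable ℝ h) (hk : Differentiable ℝ k)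
    (w : ℝ × ℝ) : Dw w (h + k) = Dw w h + Dw w k := by
  ext x; simp [Dw, fderiv_add (hh x) (hk x)]

theorem Dw_sub {h k : ℝ × ℝ → ℝ} (hh : Differentiable ℝ h) (hk : Differentiable ℝ k)
    (w : ℝ × ℝ) : Dw w (h - k) = Dw w h - Dw w k := by
  ext x; simp [Dw, fderiv_sub (hh x) (hk x)]

namespace RayAdmissible

variable {n : ℕ} {h k : ℝ × ℝ → ℝ} {w : ℝ × ℝ}

theorem of_le {m : ℕ} (hh : RayAdmissible n h) (hmn : m ≤ n) : RayAdmissible m h :=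
  ⟨hh.contDiff.of_le (by exact_mod_cast hmn), hh.vanishesAbove⟩

theorem add (hh : RayAdmissible n h) (hk : RayAdmissible n k) : RayAdmissible n (h + k) :=
  ⟨hh.contDiff.add hk.contDiff, fun y hy => by simp [hh.vanishesAbove y hy, hk.vanishesAbove y hy]⟩

theorem sub (hh : RayAdmissible n h) (hk : RayAdmissible n k) : RayAdmissible n (h - k) :=
  ⟨hh.contDiff.sub hk.contDiff, fun y hy => by simp [hh.vanishesAbove y hy, hk.vanishesAbove y hy]⟩

theorem contDiff_one (hh : RayAdmissible 1 h) : ContDiff ℝ 1 h := by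
  exact_mod_cast hh.contDiff

theorem differentiable (hh : RayAdmissible 1 h) : Differentiable ℝ h :=
  hh.contDiff_one.differentiable one_ne_zero

theorem directionalDeriv (hh : RayAdmissible (n + 1) h) (v : ℝ × ℝ) :
    RayAdmissible n (Dw v h) where
  contDiff := (hh.contDiff.fderiv_right (m := n) (by norm_cast)).clm_apply contDiff_const
  vanishesAbove y hy := by simp [Dw, hh.vanishesAbove.fderiv y hy]

theorem integrableOn (hh : RayAdmissible n h) {φ : ℝ → ℝ} (hφ : Continuous φ) (hw : 0 < w.2)
    (x : ℝ × ℝ) : IntegrableOn (fun t => φ t * h (x + t • w)) (Ioi 0) :=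
  hh.vanishesAbove.integrableOn_ray hh.contDiff.continuous hφ hw x

theorem weightedRay (hh : RayAdmissible 1 h) {φ : ℝ → ℝ} (hφ : Continuous φ) (hw : 0 < w.2) :
    RayAdmissible 1 (_root_.weightedRay φ w h) where
  contDiff := by exact_mod_cast hh.vanishesAbove.contDiff_weightedRay hh.contDiff_one hφ hw
  vanishesAbove := hh.vanishesAbove.weightedRay φ hw

theorem xray (hh : RayAdmissible 1 h) (hw : 0 < w.2) : RayAdmissible 1 (Xray w h) :=
  weightedRay_one w h ▸ hh.weightedRay continuous_const hw

theorem xray1 (hh : RayAdmissible 1 h) (hw : 0 < w.2) : RayAdmissible 1 (Xray1 w h) :=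
  weightedRay_id w h ▸ hh.weightedRay continuous_id hw

theorem Dw_weightedRay (hh : RayAdmissible 1 h) {φ : ℝ → ℝ} (hφ : Continuous φ) (hw : 0 < w.2)
    (v : ℝ × ℝ) : Dw v (_root_.weightedRay φ w h) = _root_.weightedRay φ w (Dw v h) := by
  ext x
  have hc := hh.contDiff_one
  rw [Dw, (hh.vanishesAbove.hasFDerivAt_weightedRay hc hφ hw x).fderiv, _root_.weightedRay,
    ContinuousLinearMap.integral_apply (hh.vanishesAbove.fderiv.integrableOn_ray
      (hc.continuous_fderiv one_ne_zero) hφ hw x)]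
  rfl

theorem Dw_Xray (hh : RayAdmissible 1 h) (hw : 0 < w.2) (v : ℝ × ℝ) :
    Dw v (Xray w h) = Xray w (Dw v h) := by
  simpa only [weightedRay_one] using hh.Dw_weightedRay (φ := fun _ => 1) continuous_const hw v

theorem Dw_Xray1 (hh : RayAdmissible 1 h) (hw : 0 < w.2) (v : ℝ × ℝ) :
    Dw v (Xray1 w h) = Xray1 w (Dw v h) := by
  simpa only [weightedRay_id] using hh.Dw_weightedRay (φ := fun t => t) continuous_id hw v

theorem Xray_add (hh : RayAdmissible n h) (hk : RayAdmissible n k) (hw : 0 < w.2) :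
    Xray w (h + k) = Xray w h + Xray w k := by
  ext x
  have h1 := hh.integrableOn (φ := fun _ => 1) continuous_const hw x
  have h2 := hk.integrableOn (φ := fun _ => 1) continuous_const hw x
  simp only [one_mul] at h1 h2
  exact integral_add h1 h2

theorem hasDerivAt_along (hh : RayAdmissible 1 h) (w x : ℝ × ℝ) (t : ℝ) :
    HasDerivAt (fun t : ℝ => h (x + t • w)) (Dw w h (x + t • w)) t := by
  have h1 : HasDerivAt (fun t : ℝ => x + t • w) w t := by
    simpa using ((hasDerivAt_id t).smul_const w).const_add x
  exact (hh.differentiable _).hasFDerivAt.comp_hasDerivAt t h1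

theorem eventually_eq_zero (hh : RayAdmissible n h) (hw : 0 < w.2) (x : ℝ × ℝ) :
    ∀ᶠ t : ℝ in atTop, h (x + t • w) = 0 := by
  filter_upwards [eventually_gt_atTop ((1 - x.2) / w.2)] with t ht
  refine hh.vanishesAbove _ ?_
  have := (div_lt_iff₀ hw).1 ht
  simp only [Prod.snd_add, Prod.smul_snd, smul_eq_mul]
  linarith

theorem Xray_Dw_self (hh : RayAdmissible 1 h) (hw : 0 < w.2) : Xray w (Dw w h) = -h := by
  ext x
  have h1 := (hh.directionalDeriv (n := 0) w).integrableOn (φ := fun _ => 1) continuous_const hw x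
  simp only [one_mul] at h1
  rw [Xray, integral_Ioi_of_hasDerivAt_of_tendsto' (fun t _ => hh.hasDerivAt_along w x t) h1
    (tendsto_const_nhds.congr' ((hh.eventually_eq_zero hw x).mono fun t ht => ht.symm))]
  simp

theorem Xray1_Dw_self (hh : RayAdmissible 1 h) (hw : 0 < w.2) :
    Xray1 w (Dw w h) = -Xray w h := by
  ext x
  have h1 := hh.integrableOn (φ := fun _ => 1) continuous_const hw x
  have h2 := (hh.directionalDeriv (n := 0) w).integrableOn (φ := fun t => t) continuous_id hw x
  have hlim : Tendsto (fun t : ℝ => t * h (x + t • w)) atTop (𝓝 0) :=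
    tendsto_const_nhds.congr' ((hh.eventually_eq_zero hw x).mono fun t ht => by simp [ht])
  have h3 := integral_Ioi_of_hasDerivAt_of_tendsto'
    (fun t (_ : t ∈ Ici 0) => (hasDerivAt_id' t).fun_mul (hh.hasDerivAt_along w x t))
    (h1.add h2) hlim
  simp only [zero_mul, sub_zero] at h3
  rw [integral_add h1 h2] at h3
  simp only [one_mul] at h3
  simp only [Xray, Xray1, Pi.neg_apply]
  linarith

end RayAdmissible

/-- The second-order operator `D_u D_v` applied to the first moment V-line transform. -/
theorem Dw_Dw_Xray1_add {u v : ℝ × ℝ} (hu : 0 < u.2) (hv : 0 < v.2) {g k : ℝ × ℝ → ℝ}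
    (hg : RayAdmissible 2 g) (hk : RayAdmissible 2 k) :
    Dw u (Dw v (Xray1 u g + Xray1 v k)) = -Xray u (Dw v g) - Xray v (Dw u k) := by
  have hg1 := hg.of_le one_le_two
  have hk1 := hk.of_le one_le_two
  have hvg := hg.directionalDeriv v
  rw [Dw_add (hg1.xray1 hu).differentiable (hk1.xray1 hv).differentiable, hg1.Dw_Xray1 hu,
    hk1.Dw_Xray1 hv, hk1.Xray1_Dw_self hv, ← sub_eq_add_neg,
    Dw_sub (hvg.xray1 hu).differentiable (hk1.xray hv).differentiable, hvg.Dw_Xray1 hu,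
    hvg.Xray1_Dw_self hu, hk1.Dw_Xray hv]

/-- The operator `D_u D_v` applied to a beam transform of the V-line transform. -/
theorem Dw_Dw_Xray_Vlt {u v e : ℝ × ℝ} (hu : 0 < u.2) (hv : 0 < v.2) (he : 0 < e.2)
    {g : ℝ × ℝ → ℝ} (hg : RayAdmissible 2 g) {c : ℝ} (huv : u + v = c • e) :
    Dw u (Dw v (Xray e (Vlt u v g))) = c • g := by
  have hg1 := hg.of_le one_le_two
  have hvg := hg.directionalDeriv v
  have hV : Vlt u v g = Xray u g + Xray v g := rfl
  have hsum : -Dw v g - Dw u g = Dw e ((-c) • g) := by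
    ext x
    have : fderiv ℝ g x u + fderiv ℝ g x v = c * fderiv ℝ g x e := by
      rw [← map_add, huv, map_smul, smul_eq_mul]
    simp only [Dw, Pi.sub_apply, Pi.neg_apply, fderiv_const_smul (hg1.differentiable x) (-c),
      _root_.smul_apply, smul_eq_mul]
    linarith
  have hcg : RayAdmissible 1 ((-c) • g) :=
    ⟨contDiff_const.smul hg1.contDiff, fun y hy => by simp [hg.vanishesAbove y hy]⟩
  rw [hV, ((hg1.xray hu).add (hg1.xray hv)).Dw_Xray he,
    Dw_add (hg1.xray hu).differentiable (hg1.xray hv).differentiable, hg1.Dw_Xray hu,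
    hg1.Dw_Xray hv, hg1.Xray_Dw_self hv, ← sub_eq_add_neg, ((hvg.xray hu).sub hg1).Dw_Xray he,
    Dw_sub (hvg.xray hu).differentiable hg1.differentiable, hvg.Dw_Xray hu, hvg.Xray_Dw_self hu,
    hsum, hcg.Xray_Dw_self he, neg_smul, neg_neg]

theorem RayAdmissible.of_tsupport_subset {n : ℕ} {h : ℝ × ℝ → ℝ} (hc : ContDiff ℝ n h)
    (hs : tsupport h ⊆ unitDisk) : RayAdmissible n h := by
  refine ⟨hc, fun y hy => ?_⟩
  by_contra hne
  have : y.1 ^ 2 + y.2 ^ 2 < 1 := hs (subset_tsupport h hne)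
  nlinarith [sq_nonneg y.1]

theorem RayAdmissible.proj2 {n : ℕ} {f11 f12 f22 : ℝ × ℝ → ℝ} (h11 : RayAdmissible n f11)
    (h12 : RayAdmissible n f12) (h22 : RayAdmissible n f22) (w : ℝ × ℝ) :
    RayAdmissible n (proj2 f11 f12 f22 w) where
  contDiff := by
    have := h11.contDiff
    have := h12.contDiff
    have := h22.contDiff
    unfold _root_.proj2
    fun_prop
  vanishesAbove y hy := by
    simp [_root_.proj2, h11.vanishesAbove y hy, h12.vanishesAbove y hy, h22.vanishesAbove y hy]

theorem proj2_add_proj2_perp (f11 f12 f22 : ℝ × ℝ → ℝ) {w : ℝ × ℝ}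
    (hw : w.1 ^ 2 + w.2 ^ 2 = 1) :
    proj2 f11 f12 f22 w + proj2 f11 f12 f22 (perp w) = f11 + f22 := by
  ext x
  simp only [proj2, perp, Pi.add_apply]
  linear_combination (f11 x + f22 x) * hw

theorem Lf_add_Tf {n : ℕ} {f11 f12 f22 : ℝ × ℝ → ℝ} (h11 : RayAdmissible n f11)
    (h12 : RayAdmissible n f12) (h22 : RayAdmissible n f22) {u v : ℝ × ℝ}
    (hu : 0 < u.2) (hv : 0 < v.2) (hu1 : u.1 ^ 2 + u.2 ^ 2 = 1) (hv1 : v.1 ^ 2 + v.2 ^ 2 = 1) :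
    (fun y => Lf u v f11 f12 f22 y + Tf u v f11 f12 f22 y) = Vlt u v (f11 + f22) := by
  ext y
  have hadd {w : ℝ × ℝ} (hw : 0 < w.2) (hw1 : w.1 ^ 2 + w.2 ^ 2 = 1) :
      Xray w (f11 + f22) y =
        Xray w (proj2 f11 f12 f22 w) y + Xray w (proj2 f11 f12 f22 (perp w)) y := by
    rw [← proj2_add_proj2_perp f11 f12 f22 hw1, (h11.proj2 h12 h22 w).Xray_add
      (h11.proj2 h12 h22 (perp w)) hw, Pi.add_apply]
  rw [Vlt, hadd hu hu1, hadd hv hv1, Lf, Tf]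
  ring

theorem stmt_16 (u1 u2 : ℝ) (hu1 : 0 < u1) (hu2 : 0 < u2) (huv : u1 ^ 2 + u2 ^ 2 = 1)
    (f11 f12 f22 : ℝ × ℝ → ℝ)
    (hf11 : ContDiff ℝ 2 f11) (hf12 : ContDiff ℝ 2 f12) (hf22 : ContDiff ℝ 2 f22)
    (hs11 : tsupport f11 ⊆ unitDisk) (hs12 : tsupport f12 ⊆ unitDisk)
    (hs22 : tsupport f22 ⊆ unitDisk)
    (hune : u1 ≠ u2) :
    ∀ x : ℝ × ℝ,
      f22 x =
        (1 / (2 * (u1 ^ 2 - u2 ^ 2))) *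
          (Dw (u1, u2) (Dw (-u1, u2) (L1f (u1, u2) (-u1, u2) f11 f12 f22)) x +
            Dw (u1, u2) (Lf (u1, u2) (-u1, u2) f11 f12 f22) x + Dw (-u1, u2) (Lf (u1, u2) (-u1, u2) f11 f12 f22) x +
            (u1 ^ 2 / u2) * Dw (u1, u2) (Dw (-u1, u2) (Xray (0, 1) (fun y => Lf (u1, u2) (-u1, u2) f11 f12 f22 y + Tf (u1, u2) (-u1, u2) f11 f12 f22 y))) x) := by
  intro x
  have h11 : RayAdmissible 2 f11 := .of_tsupport_subset hf11 hs11
  have h12 : RayAdmissible 2 f12 := .of_tsupport_subset hf12 hs12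
  have h22 : RayAdmissible 2 f22 := .of_tsupport_subset hf22 hs22
  have hL : Lf (u1, u2) (-u1, u2) f11 f12 f22 = Xray (u1, u2) (proj2 f11 f12 f22 (u1, u2)) +
    Xray (-u1, u2) (proj2 f11 f12 f22 (-u1, u2)) := rfl
  have hL1 : L1f (u1, u2) (-u1, u2) f11 f12 f22 = Xray1 (u1, u2) (proj2 f11 f12 f22 (u1, u2)) +
    Xray1 (-u1, u2) (proj2 f11 f12 f22 (-u1, u2)) := rfl
  have hg := h11.proj2 h12 h22 (u1, u2)
  have hk := h11.proj2 h12 h22 (-u1, u2)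
  have hg1 := hg.of_le one_le_two
  have hk1 := hk.of_le one_le_two
  rw [Lf_add_Tf h11 h12 h22 hu2 hu2 huv (by simpa using huv),
    Dw_Dw_Xray_Vlt (c := 2 * u2) hu2 hu2 (by simp) (h11.add h22) (by ext <;> simp; ring),
    hL1, Dw_Dw_Xray1_add hu2 hu2 hg hk, hL,
    Dw_add (hg1.xray hu2).differentiable (hk1.xray hu2).differentiable,
    Dw_add (hg1.xray hu2).differentiable (hk1.xray hu2).differentiable,
    hg1.Dw_Xray hu2, hg1.Dw_Xray hu2, hk1.Dw_Xray hu2, hk1.Dw_Xray hu2, hg1.Xray_Dw_self hu2,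
    hk1.Xray_Dw_self hu2]
  have hne : u1 ^ 2 - u2 ^ 2 ≠ 0 := by
    rw [sq_sub_sq]
    exact mul_ne_zero (by positivity) (sub_ne_zero.2 hune)
  simp only [Pi.add_apply, Pi.sub_apply, Pi.neg_apply, Pi.smul_apply, smul_eq_mul, proj2]
  field_simp
  ring
end
end

section
/- Let f = (f11,f12,f22) be a symmetric 2-tensor field with C² components compactly supported in the open unit disk. Then for every x ∈ ℝ², f11(x) = -(1/2)·{ D_u D_v (L¹f)(x) + D_u(Lf)(x) + D_v(Lf)(x) - (u2/u1²)·D_u D_v X_{-e1}[ (u1² - u2²)·V(f12) - Mf ](x) }, where X_{-e1} denotes the divergent beam transform in the direction -e1 and V(f12) = X_u f12 + X_v f12. -/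
open MeasureTheory

noncomputable section

/-- Along the rays with direction `w`, the function `h` vanishes after a time that is uniform for
starting points in bounded sets. -/
def EscapesAlong (w : ℝ × ℝ) (h : ℝ × ℝ → ℝ) : Prop :=
  ∀ R : ℝ, ∃ T : ℝ, 0 ≤ T ∧ ∀ x : ℝ × ℝ, ‖x‖ < R → ∀ t : ℝ, T ≤ t → h (x + t • w) = 0

/-- The divergent beam transform with weight `φ`. -/
def weightedXray (φ : ℝ → ℝ) (w : ℝ × ℝ) (h : ℝ × ℝ → ℝ) (x : ℝ × ℝ) : ℝ :=
  ∫ t in Set.Ioi (0:ℝ), φ t * h (x + t • w)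

lemma Xray_eq_weightedXray (w : ℝ × ℝ) (h : ℝ × ℝ → ℝ) :
    Xray w h = weightedXray (fun _ => 1) w h := by
  funext x; simp [Xray, weightedXray]

lemma Xray1_eq_weightedXray (w : ℝ × ℝ) (h : ℝ × ℝ → ℝ) :
    Xray1 w h = weightedXray (fun t => t) w h := rfl

lemma weightedXray_eq_intervalIntegral {φ : ℝ → ℝ} {w x : ℝ × ℝ} {h : ℝ × ℝ → ℝ} {T : ℝ}
    (hT : 0 ≤ T) (hz : ∀ t : ℝ, T ≤ t → h (x + t • w) = 0) :
    weightedXray φ w h x = ∫ t in (0:ℝ)..T, φ t * h (x + t • w) := by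
  rw [weightedXray, intervalIntegral.integral_of_le hT]
  refine setIntegral_eq_of_subset_of_forall_sdiff_eq_zero measurableSet_Ioi
    Set.Ioc_subset_Ioi_self ?_
  intro t ht
  have : T ≤ t := by
    by_contra hlt
    exact ht.2 ⟨ht.1, (not_le.mp hlt).le⟩
  rw [hz t this, mul_zero]

namespace EscapesAlong

variable {w : ℝ × ℝ} {h g : ℝ × ℝ → ℝ}

lemma sub (hh : EscapesAlong w h) (hg : EscapesAlong w g) :
    EscapesAlong w (fun x => h x - g x) := by
  intro R
  obtain ⟨T, hT, hz⟩ := hh R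
  obtain ⟨S, hS, hy⟩ := hg R
  refine ⟨max T S, le_max_of_le_left hT, fun x hx t ht => ?_⟩
  simp [hz x hx t ((le_max_left _ _).trans ht), hy x hx t ((le_max_right _ _).trans ht)]

lemma Dw (hh : EscapesAlong w h) (a : ℝ × ℝ) : EscapesAlong w (Dw a h) := by
  intro R
  obtain ⟨T, hT, hz⟩ := hh R
  refine ⟨T, hT, fun x hx t ht => ?_⟩
  have hev : h =ᶠ[nhds (x + t • w)] fun _ => 0 := by
    have hcont : ContinuousAt (fun y : ℝ × ℝ => ‖y - t • w‖) (x + t • w) := by fun_prop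
    have hlt : ∀ᶠ y in nhds (x + t • w), ‖y - t • w‖ < R :=
      hcont.eventually_lt continuousAt_const (by simpa using hx)
    filter_upwards [hlt] with y hy
    simpa using hz (y - t • w) hy t ht
  simp [_root_.Dw, hev.fderiv_eq]

lemma exists_time (hh : EscapesAlong w h) (x : ℝ × ℝ) :
    ∃ T : ℝ, 0 ≤ T ∧ ∀ᶠ y in nhds x, ∀ t : ℝ, T ≤ t → h (y + t • w) = 0 := by
  obtain ⟨T, hT, hz⟩ := hh (‖x‖ + 1)
  refine ⟨T, hT, ?_⟩
  have hlt : ∀ᶠ y in nhds x, ‖y‖ < ‖x‖ + 1 :=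
    continuous_norm.continuousAt.eventually_lt continuousAt_const (by simp)
  filter_upwards [hlt] with y hy using hz y hy

lemma integrableOn (hh : EscapesAlong w h) (hc : Continuous h) (x : ℝ × ℝ) :
    IntegrableOn (fun t : ℝ => h (x + t • w)) (Set.Ioi 0) := by
  obtain ⟨T, hT, hz⟩ := hh.exists_time x
  have hI : IntegrableOn (fun t : ℝ => h (x + t • w)) (Set.Icc 0 T) :=
    Continuous.integrableOn_Icc (by fun_prop)
  refine hI.of_forall_sdiff_eq_zero measurableSet_Ioi fun t ht => hz.self_of_nhds t ?_
  by_contra hlt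
  exact ht.2 ⟨(Set.mem_Ioi.mp ht.1).le, (not_le.mp hlt).le⟩

end EscapesAlong

section Regularity

variable {φ : ℝ → ℝ} {w : ℝ × ℝ} {h : ℝ × ℝ → ℝ}

lemma hasFDerivAt_intervalIntegral_ray (hφ : Continuous φ) (hh : ContDiff ℝ 1 h) (T : ℝ)
    (x : ℝ × ℝ) :
    HasFDerivAt (fun y : ℝ × ℝ => ∫ t in (0:ℝ)..T, φ t * h (y + t • w))
      (∫ t in (0:ℝ)..T, φ t • fderiv ℝ h (x + t • w)) x := by
  have hc := hh.continuous
  have hc' : Continuous (fderiv ℝ h) := hh.continuous_fderiv one_ne_zero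
  have hF' : Continuous fun p : (ℝ × ℝ) × ℝ => φ p.2 • fderiv ℝ h (p.1 + p.2 • w) := by fun_prop
  obtain ⟨C, hC⟩ := ((isCompact_closedBall x 1).prod
    (isCompact_uIcc (a := (0:ℝ)) (b := T))).exists_bound_of_continuousOn hF'.continuousOn
  refine intervalIntegral.hasFDerivAt_integral_of_dominated_of_fderiv_le
    (F := fun y t => φ t * h (y + t • w)) (F' := fun y t => φ t • fderiv ℝ h (y + t • w))
    (bound := fun _ => C) (Metric.closedBall_mem_nhds x one_pos) ?_ ?_ ?_ ?_ ?_ ?_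
  · exact Filter.Eventually.of_forall fun y =>
      Continuous.aestronglyMeasurable (by fun_prop)
  · exact Continuous.intervalIntegrable (by fun_prop) _ _
  · exact Continuous.aestronglyMeasurable (by fun_prop)
  · exact Filter.Eventually.of_forall fun t ht y hy => hC (y, t) ⟨hy, Set.uIoc_subset_uIcc ht⟩
  · simp
  · refine Filter.Eventually.of_forall fun t _ y _ => ?_
    have hd : HasFDerivAt h (fderiv ℝ h (y + t • w)) (y + t • w) :=
      (hh.differentiable one_ne_zero _).hasFDerivAt
    have := hd.comp y ((hasFDerivAt_id y).add_const (t • w))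
    exact this.const_mul (φ t)

lemma hasFDerivAt_weightedXray (hφ : Continuous φ) (hh : ContDiff ℝ 1 h) {T : ℝ} (hT : 0 ≤ T)
    {x : ℝ × ℝ} (hz : ∀ᶠ y in nhds x, ∀ t : ℝ, T ≤ t → h (y + t • w) = 0) :
    HasFDerivAt (weightedXray φ w h) (∫ t in (0:ℝ)..T, φ t • fderiv ℝ h (x + t • w)) x :=
  (hasFDerivAt_intervalIntegral_ray hφ hh T x).congr_of_eventuallyEq
    (hz.mono fun _ hy => weightedXray_eq_intervalIntegral hT hy)

lemma contDiff_weightedXray (hφ : Continuous φ) (hh : ContDiff ℝ 1 h) (he : EscapesAlong w h) :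
    ContDiff ℝ 1 (weightedXray φ w h) := by
  rw [contDiff_one_iff_fderiv]
  refine ⟨fun x => ?_, continuous_iff_continuousAt.mpr fun x => ?_⟩
  · obtain ⟨T, hT, hz⟩ := he.exists_time x
    exact (hasFDerivAt_weightedXray hφ hh hT hz).differentiableAt
  · obtain ⟨T, hT, hz⟩ := he.exists_time x
    have hc' : Continuous (fderiv ℝ h) := hh.continuous_fderiv one_ne_zero
    have hcont : Continuous fun y : ℝ × ℝ => ∫ t in (0:ℝ)..T, φ t • fderiv ℝ h (y + t • w) :=
      intervalIntegral.continuous_parametric_intervalIntegral_of_continuous' (by fun_prop) _ _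
    refine hcont.continuousAt.congr ?_
    filter_upwards [hz.eventually_nhds] with y hy
    exact (hasFDerivAt_weightedXray hφ hh hT hy).fderiv.symm

lemma Dw_weightedXray (hφ : Continuous φ) (hh : ContDiff ℝ 1 h) (he : EscapesAlong w h)
    (a : ℝ × ℝ) : Dw a (weightedXray φ w h) = weightedXray φ w (Dw a h) := by
  funext x
  obtain ⟨T, hT, hz⟩ := (he.Dw a).exists_time x
  obtain ⟨S, hS, hy⟩ := he.exists_time x
  have hc' : Continuous (fderiv ℝ h) := hh.continuous_fderiv one_ne_zero
  have hy' := hy.mono fun y hy t (ht : max T S ≤ t) => hy t ((le_max_right _ _).trans ht)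
  rw [weightedXray_eq_intervalIntegral (T := max T S) (le_max_of_le_left hT)
      fun t ht => hz.self_of_nhds t ((le_max_left _ _).trans ht),
    Dw, (hasFDerivAt_weightedXray hφ hh (le_max_of_le_left hT) hy').fderiv,
    ContinuousLinearMap.intervalIntegral_apply]
  · rfl
  · exact Continuous.intervalIntegrable (by fun_prop) _ _

lemma contDiff_Dw {n : WithTop ℕ∞} (hh : ContDiff ℝ (n + 1) h) (a : ℝ × ℝ) :
    ContDiff ℝ n (Dw a h) :=
  (hh.fderiv_right le_rfl).clm_apply contDiff_const

lemma contDiff_Xray (hh : ContDiff ℝ 1 h) (he : EscapesAlong w h) : ContDiff ℝ 1 (Xray w h) := by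
  rw [Xray_eq_weightedXray]
  exact contDiff_weightedXray continuous_const hh he

lemma contDiff_Xray1 (hh : ContDiff ℝ 1 h) (he : EscapesAlong w h) :
    ContDiff ℝ 1 (Xray1 w h) :=
  contDiff_weightedXray continuous_id hh he

lemma Dw_Xray (hh : ContDiff ℝ 1 h) (he : EscapesAlong w h) (a : ℝ × ℝ) :
    Dw a (Xray w h) = Xray w (Dw a h) := by
  rw [Xray_eq_weightedXray, Xray_eq_weightedXray]
  exact Dw_weightedXray continuous_const hh he a

lemma Dw_Xray1 (hh : ContDiff ℝ 1 h) (he : EscapesAlong w h) (a : ℝ × ℝ) :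
    Dw a (Xray1 w h) = Xray1 w (Dw a h) :=
  Dw_weightedXray continuous_id hh he a

lemma hasDerivAt_ray (hh : ContDiff ℝ 1 h) (x : ℝ × ℝ) (t : ℝ) :
    HasDerivAt (fun s : ℝ => h (x + s • w)) (Dw w h (x + t • w)) t := by
  have hd : HasFDerivAt h (fderiv ℝ h (x + t • w)) (x + t • w) :=
    (hh.differentiable one_ne_zero _).hasFDerivAt
  have hl : HasDerivAt (fun s : ℝ => x + s • w) w t := by
    simpa using ((hasDerivAt_id t).smul_const w).const_add x
  exact hd.comp_hasDerivAt t hl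

lemma Xray_Dw_self (hh : ContDiff ℝ 1 h) (he : EscapesAlong w h) :
    Xray w (Dw w h) = fun x => -h x := by
  funext x
  obtain ⟨T, hT, hz⟩ := (he.Dw w).exists_time x
  obtain ⟨S, hS, hy⟩ := he.exists_time x
  have hc : Continuous (Dw w h) := (contDiff_Dw (n := 0) (by simpa using hh) w).continuous
  rw [Xray_eq_weightedXray, weightedXray_eq_intervalIntegral (T := max T S)
    (le_max_of_le_left hT) fun t ht => hz.self_of_nhds t ((le_max_left _ _).trans ht)]
  simp only [one_mul]
  rw [intervalIntegral.integral_eq_sub_of_hasDerivAt (fun t _ => hasDerivAt_ray hh x t)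
    (Continuous.intervalIntegrable (by fun_prop) _ _), hy.self_of_nhds _ (le_max_right _ _)]
  simp

lemma Xray1_Dw_self (hh : ContDiff ℝ 1 h) (he : EscapesAlong w h) :
    Xray1 w (Dw w h) = fun x => -Xray w h x := by
  funext x
  obtain ⟨T, hT, hz⟩ := (he.Dw w).exists_time x
  obtain ⟨S, hS, hy⟩ := he.exists_time x
  have hc : Continuous (Dw w h) := (contDiff_Dw (n := 0) (by simpa using hh) w).continuous
  have hc0 := hh.continuous
  rw [Xray1_eq_weightedXray, Xray_eq_weightedXray,
    weightedXray_eq_intervalIntegral (T := max T S)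
      (le_max_of_le_left hT) fun t ht => hz.self_of_nhds t ((le_max_left _ _).trans ht),
    weightedXray_eq_intervalIntegral (T := max T S)
      (le_max_of_le_left hT) fun t ht => hy.self_of_nhds t ((le_max_right _ _).trans ht),
    intervalIntegral.integral_mul_deriv_eq_deriv_mul (fun t _ => hasDerivAt_id' t)
      (fun t _ => hasDerivAt_ray hh x t) (Continuous.intervalIntegrable (by fun_prop) _ _)
      (Continuous.intervalIntegrable (by fun_prop) _ _),
    hy.self_of_nhds _ (le_max_right _ _)]
  simp

end Regularity

lemma Dw_add_s17 {h g : ℝ × ℝ → ℝ} (hh : ContDiff ℝ 1 h) (hg : ContDiff ℝ 1 g) (a : ℝ × ℝ) :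
    Dw a (fun x => h x + g x) = fun x => Dw a h x + Dw a g x := by
  funext x
  simp [Dw, fderiv_fun_add (hh.differentiable one_ne_zero x) (hg.differentiable one_ne_zero x)]

lemma Dw_sub_s17 {h g : ℝ × ℝ → ℝ} (hh : ContDiff ℝ 1 h) (hg : ContDiff ℝ 1 g) (a : ℝ × ℝ) :
    Dw a (fun x => h x - g x) = fun x => Dw a h x - Dw a g x := by
  funext x
  simp [Dw, fderiv_fun_sub (hh.differentiable one_ne_zero x) (hg.differentiable one_ne_zero x)]

lemma Dw_neg (h : ℝ × ℝ → ℝ) (a : ℝ × ℝ) : Dw a (fun x => -h x) = fun x => -Dw a h x := by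
  funext x
  simp [Dw, fderiv_fun_neg]

lemma Xray_const_mul (w : ℝ × ℝ) (c : ℝ) (h : ℝ × ℝ → ℝ) :
    Xray w (fun x => c * h x) = fun x => c * Xray w h x := by
  funext x
  simp only [Xray, integral_const_mul]

lemma Xray_sub {w : ℝ × ℝ} {h g : ℝ × ℝ → ℝ} (hh : Continuous h) (hg : Continuous g)
    (eh : EscapesAlong w h) (eg : EscapesAlong w g) :
    Xray w (fun x => h x - g x) = fun x => Xray w h x - Xray w g x := by
  funext x
  exact integral_sub (eh.integrableOn hh x) (eg.integrableOn hg x)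

section Support

variable {h : ℝ × ℝ → ℝ}

lemma eq_zero_of_one_le_norm (hs : tsupport h ⊆ unitDisk) {x : ℝ × ℝ} (hx : 1 ≤ ‖x‖) :
    h x = 0 := by
  by_contra hne
  have hlt : x.1 ^ 2 + x.2 ^ 2 < 1 := hs (subset_tsupport h hne)
  rw [Prod.norm_def, le_max_iff, Real.norm_eq_abs, Real.norm_eq_abs] at hx
  rcases hx with hx | hx
  · nlinarith [(one_le_sq_iff_one_le_abs x.1).mpr hx, sq_nonneg x.2]
  · nlinarith [(one_le_sq_iff_one_le_abs x.2).mpr hx, sq_nonneg x.1]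

lemma escapesAlong_of_support (hs : ∀ x : ℝ × ℝ, 1 ≤ ‖x‖ → h x = 0) {w : ℝ × ℝ} (hw : w ≠ 0) :
    EscapesAlong w h := by
  intro R
  have hw' : 0 < ‖w‖ := norm_pos_iff.mpr hw
  refine ⟨max 0 ((R + 1) / ‖w‖), le_max_left _ _, fun x hx t ht => hs _ ?_⟩
  have ht0 : 0 ≤ t := (le_max_left _ _).trans ht
  have h1 : R + 1 ≤ t * ‖w‖ := (div_le_iff₀ hw').mp ((le_max_right _ _).trans ht)
  have h2 : ‖t • w‖ ≤ ‖x + t • w‖ + ‖x‖ := by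
    simpa using norm_sub_le (x + t • w) x
  rw [norm_smul, Real.norm_of_nonneg ht0] at h2
  linarith

lemma escapesAlong_Xray (hs : ∀ x : ℝ × ℝ, 1 ≤ ‖x‖ → h x = 0) {w : ℝ × ℝ} (hw : 0 < w.2) :
    EscapesAlong (-1, 0) (Xray w h) := by
  intro R
  refine ⟨max 0 (1 + R + |w.1| * ((1 + R) / w.2)), le_max_left _ _, fun x hx t ht => ?_⟩
  have ht' := (le_max_right _ _).trans ht
  rw [Prod.norm_def, max_lt_iff, Real.norm_eq_abs, Real.norm_eq_abs, abs_lt, abs_lt] at hx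
  refine setIntegral_eq_zero_of_forall_eq_zero fun s hs0 => hs _ ?_
  have hs0 : 0 < s := hs0
  rw [Prod.norm_def, le_max_iff, Real.norm_eq_abs, Real.norm_eq_abs]
  by_contra! hlt
  simp only [Prod.fst_add, Prod.snd_add, Prod.smul_fst, Prod.smul_snd, smul_eq_mul,
    abs_lt] at hlt
  have hs1 : s ≤ (1 + R) / w.2 := by
    rw [le_div_iff₀ hw]
    linarith [hlt.2.2, hx.2.1]
  have h1 : s * w.1 ≤ |w.1| * ((1 + R) / w.2) := by
    calc s * w.1 ≤ s * |w.1| := mul_le_mul_of_nonneg_left (le_abs_self _) hs0.le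
      _ = |w.1| * s := mul_comm _ _
      _ ≤ _ := mul_le_mul_of_nonneg_left hs1 (abs_nonneg _)
  linarith [hlt.1.1, hx.1.2]

end Support

section VLine

variable {u v : ℝ × ℝ}

lemma Dw_Dw_moment {g k : ℝ × ℝ → ℝ} (hg : ContDiff ℝ 2 g) (hk : ContDiff ℝ 2 k)
    (eg : EscapesAlong u g) (ek : EscapesAlong v k) :
    Dw u (Dw v (fun x => Xray1 u g x + Xray1 v k x)) =
      fun x => -Xray u (Dw v g) x - Xray v (Dw u k) x := by
  have hg1 : ContDiff ℝ 1 g := hg.of_le one_le_two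
  have hk1 : ContDiff ℝ 1 k := hk.of_le one_le_two
  have hDg : ContDiff ℝ 1 (Dw v g) := contDiff_Dw (by simpa [one_add_one_eq_two] using hg) v
  rw [Dw_add_s17 (contDiff_Xray1 hg1 eg) (contDiff_Xray1 hk1 ek), Dw_Xray1 hg1 eg, Dw_Xray1 hk1 ek,
    Xray1_Dw_self hk1 ek, Dw_add_s17 (contDiff_Xray1 hDg (eg.Dw v)) (contDiff_Xray hk1 ek).neg,
    Dw_Xray1 hDg (eg.Dw v), Xray1_Dw_self hDg (eg.Dw v), Dw_neg, Dw_Xray hk1 ek]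
  rfl

lemma Dw_Xray_add {g k : ℝ × ℝ → ℝ} (hg : ContDiff ℝ 1 g) (hk : ContDiff ℝ 1 k)
    (eg : EscapesAlong u g) (ek : EscapesAlong v k) (a : ℝ × ℝ) :
    Dw a (fun x => Xray u g x + Xray v k x) =
      fun x => Xray u (Dw a g) x + Xray v (Dw a k) x := by
  rw [Dw_add_s17 (contDiff_Xray hg eg) (contDiff_Xray hk ek), Dw_Xray hg eg, Dw_Xray hk ek]

/-- The signed V-line transform is inverted by `D_u D_v` up to a horizontal derivative, which the
horizontal divergent beam transform undoes. -/
lemma Dw_Dw_Xray_signed {h : ℝ × ℝ → ℝ} (hh : ContDiff ℝ 2 h)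
    (hs : ∀ x : ℝ × ℝ, 1 ≤ ‖x‖ → h x = 0) (hu : 0 < u.2) (hv : 0 < v.2) {c : ℝ}
    (huv : u - v = c • (1, 0)) (x : ℝ × ℝ) :
    Dw u (Dw v (Xray (-1, 0) (fun y => Xray u h y - Xray v h y))) x = c * h x := by
  have eh (w : ℝ × ℝ) (hw : w ≠ 0) : EscapesAlong w h := escapesAlong_of_support hs hw
  have eu : EscapesAlong u h := eh u (by rintro rfl; simp at hu)
  have ev : EscapesAlong v h := eh v (by rintro rfl; simp at hv)
  have he : EscapesAlong (-1, 0) h := eh _ (by simp)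
  have hh1 : ContDiff ℝ 1 h := hh.of_le one_le_two
  have hDh : ContDiff ℝ 1 (Dw v h) := contDiff_Dw (by simpa [one_add_one_eq_two] using hh) v
  have hk : ContDiff ℝ 1 (fun y => Xray u h y - Xray v h y) :=
    (contDiff_Xray hh1 eu).sub (contDiff_Xray hh1 ev)
  have ek : EscapesAlong (-1, 0) (fun y => Xray u h y - Xray v h y) :=
    (escapesAlong_Xray hs hu).sub (escapesAlong_Xray hs hv)
  have hDvk : Dw v (fun y => Xray u h y - Xray v h y) = fun y => Xray u (Dw v h) y + h y := by
    rw [Dw_sub_s17 (contDiff_Xray hh1 eu) (contDiff_Xray hh1 ev), Dw_Xray hh1 eu, Dw_Xray hh1 ev,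
      Xray_Dw_self hh1 ev]
    simp
  have hDDk : Dw u (fun y => Xray u (Dw v h) y + h y) = fun y => -c * Dw (-1, 0) h y := by
    rw [Dw_add_s17 (contDiff_Xray hDh (eu.Dw v)) hh1, Dw_Xray hDh (eu.Dw v),
      Xray_Dw_self hDh (eu.Dw v)]
    funext y
    have : Dw u h y - Dw v h y = -c * Dw (-1, 0) h y := by
      rw [Dw, Dw, Dw, ← map_sub, huv, ← smul_eq_mul, ← map_smul]
      simp
    linarith
  have hDk : ContDiff ℝ 1 (fun y => Xray u (Dw v h) y + h y) :=
    (contDiff_Xray hDh (eu.Dw v)).add hh1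
  have eDk : EscapesAlong (-1, 0) (fun y => Xray u (Dw v h) y + h y) := hDvk ▸ ek.Dw v
  rw [Dw_Xray hk ek, hDvk, Dw_Xray hDk eDk, hDDk, Xray_const_mul, Xray_Dw_self hh1 he]
  ring

end VLine

theorem stmt_17 (u1 u2 : ℝ) (hu1 : 0 < u1) (hu2 : 0 < u2) (huv : u1 ^ 2 + u2 ^ 2 = 1)
    (f11 f12 f22 : ℝ × ℝ → ℝ)
    (hf11 : ContDiff ℝ 2 f11) (hf12 : ContDiff ℝ 2 f12) (hf22 : ContDiff ℝ 2 f22)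
    (hs11 : tsupport f11 ⊆ unitDisk) (hs12 : tsupport f12 ⊆ unitDisk)
    (hs22 : tsupport f22 ⊆ unitDisk) :
    ∀ x : ℝ × ℝ,
      f11 x =
        -(1 / 2) *
          (Dw (u1, u2) (Dw (-u1, u2) (L1f (u1, u2) (-u1, u2) f11 f12 f22)) x +
            Dw (u1, u2) (Lf (u1, u2) (-u1, u2) f11 f12 f22) x + Dw (-u1, u2) (Lf (u1, u2) (-u1, u2) f11 f12 f22) x -
            (u2 / u1 ^ 2) * Dw (u1, u2) (Dw (-u1, u2) (Xray (-1, 0) (fun y =>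
              (u1 ^ 2 - u2 ^ 2) * (Xray (u1, u2) f12 y + Xray (-u1, u2) f12 y) -
                Mf (u1, u2) (-u1, u2) f11 f12 f22 y))) x) := by
  intro x
  have z11 (y : ℝ × ℝ) (hy : 1 ≤ ‖y‖) := eq_zero_of_one_le_norm hs11 hy
  have z12 (y : ℝ × ℝ) (hy : 1 ≤ ‖y‖) := eq_zero_of_one_le_norm hs12 hy
  have z22 (y : ℝ × ℝ) (hy : 1 ≤ ‖y‖) := eq_zero_of_one_le_norm hs22 hy
  set u : ℝ × ℝ := (u1, u2) with hu
  set v : ℝ × ℝ := (-u1, u2) with hv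
  have u0 : u ≠ 0 := by simp [hu, hu1.ne']
  have v0 : v ≠ 0 := by simp [hv, hu1.ne']
  have hP (w : ℝ × ℝ) : ContDiff ℝ 2 (proj2 f11 f12 f22 w) := by unfold proj2; fun_prop
  have hP1 (w : ℝ × ℝ) : ContDiff ℝ 1 (proj2 f11 f12 f22 w) := (hP w).of_le one_le_two
  have eP (w : ℝ × ℝ) (hw : w ≠ 0) : EscapesAlong w (proj2 f11 f12 f22 w) :=
    escapesAlong_of_support (fun y hy => by simp [proj2, z11 y hy, z12 y hy, z22 y hy]) hw
  have hL1 := congrFun (Dw_Dw_moment (hP u) (hP v) (eP u u0) (eP v v0)) x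
  have hLu := congrFun (Dw_Xray_add (hP1 u) (hP1 v) (eP u u0) (eP v v0) u) x
  have hLv := congrFun (Dw_Xray_add (hP1 u) (hP1 v) (eP u u0) (eP v v0) v) x
  rw [Xray_Dw_self (hP1 u) (eP u u0)] at hLu
  rw [Xray_Dw_self (hP1 v) (eP v v0)] at hLv
  -- The bracket only sees the trace-free diagonal part of the tensor field.
  have hd : ContDiff ℝ 2 (fun y => u1 * u2 * (f11 y - f22 y)) := by fun_prop
  have zd (y : ℝ × ℝ) (hy : 1 ≤ ‖y‖) : u1 * u2 * (f11 y - f22 y) = 0 := by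
    simp [z11 y hy, z22 y hy]
  have hmix : (fun y => (u1 ^ 2 - u2 ^ 2) * (Xray u f12 y + Xray v f12 y) -
      Mf u v f11 f12 f22 y) = fun y => Xray u (fun y => u1 * u2 * (f11 y - f22 y)) y -
        Xray v (fun y => u1 * u2 * (f11 y - f22 y)) y := by
    have hc12 : Continuous fun y => (u1 ^ 2 - u2 ^ 2) * f12 y := by
      have := hf12.continuous
      fun_prop
    have e12 (w : ℝ × ℝ) (hw : w ≠ 0) : EscapesAlong w fun y => (u1 ^ 2 - u2 ^ 2) * f12 y :=
      escapesAlong_of_support (fun y hy => by simp [z12 y hy]) hw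
    have hM (w : ℝ × ℝ) : Continuous (projMix f11 f12 f22 w) := by
      have := hf11.continuous
      have := hf12.continuous
      have := hf22.continuous
      unfold projMix
      fun_prop
    have eM (w : ℝ × ℝ) (hw : w ≠ 0) : EscapesAlong w (projMix f11 f12 f22 w) :=
      escapesAlong_of_support (fun y hy => by simp [projMix, z11 y hy, z12 y hy, z22 y hy]) hw
    have hXu : Xray u (fun y => u1 * u2 * (f11 y - f22 y)) =
        fun y => (u1 ^ 2 - u2 ^ 2) * Xray u f12 y - Xray u (projMix f11 f12 f22 u) y := by
      have hsub := Xray_sub hc12 (hM u) (e12 u u0) (eM u u0)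
      rw [Xray_const_mul] at hsub
      rw [← hsub]
      congr 1
      funext y
      simp only [projMix, hu]
      ring
    have hXv : Xray v (fun y => u1 * u2 * (f11 y - f22 y)) =
        fun y => Xray v (projMix f11 f12 f22 v) y - (u1 ^ 2 - u2 ^ 2) * Xray v f12 y := by
      have hsub := Xray_sub (hM v) hc12 (eM v v0) (e12 v v0)
      rw [Xray_const_mul] at hsub
      rw [← hsub]
      congr 1
      funext y
      simp only [projMix, hv]
      ring
    funext y
    rw [hXu, hXv, Mf]
    ring
  have hX := Dw_Dw_Xray_signed (u := u) (v := v) (c := 2 * u1) hd zd hu2 hu2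
    (by simp [hu, hv]; ring) x
  change f11 x = -(1 / 2) * (Dw u (Dw v fun x => Xray1 u (proj2 f11 f12 f22 u) x +
      Xray1 v (proj2 f11 f12 f22 v) x) x +
    Dw u (fun x => Xray u (proj2 f11 f12 f22 u) x + Xray v (proj2 f11 f12 f22 v) x) x +
    Dw v (fun x => Xray u (proj2 f11 f12 f22 u) x + Xray v (proj2 f11 f12 f22 v) x) x - _)
  rw [hmix, hX, hL1, hLu, hLv]
  simp only [proj2, hu, hv]
  field_simp
  linear_combination (-2 * f11 x) * huv
end
end
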